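/- For every h-normal Γ-linear connection, the curvature R(X,Y)Z of the induced covariant derivative ∇ satisfies on the adapted frame: R(X,Y)(δ/δt) = 0 for all adapted frame fields X, Y; R(δ/δx^k, δ/δt)(δ/δx^i) = R^l_i1k δ/δx^l and R(δ/δx^k, δ/δt)(∂/∂y^i) = R^l_i1k ∂/∂y^l; R(δ/δx^k, δ/δx^j)(δ/δx^i) = R^l_ijk δ/δx^l and R(δ/δx^k, δ/δx^j)(∂/∂y^i) = R^l_ijk ∂/∂y^l; R(∂/∂y^k, δ/δt)(δ/δx^i) = P^l_i1(k) δ/δx^l and R(∂/∂y^k, δ/δt)(∂/∂y^i) = P^l_i1(k) ∂/∂y^l; R(∂/∂y^k, δ/δx^j)(δ/δx^i) = P^l_ij(k) δ/δx^l and R(∂/∂y^k, δ/δx^j)(∂/∂y^i) = P^l_ij(k) ∂/∂y^l; R(∂/∂y^k, ∂/∂y^j)(δ/δx^i) = S^l_i(j)(k) δ/δx^l and R(∂/∂y^k, ∂/∂y^j)(∂/∂y^i) = S^l_i(j)(k) ∂/∂y^l, where R^l_i1k, R^l_ijk, P^l_i1(k), P^l_ij(k), S^l_i(j)(k) are the five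 curvature d-tensors defined in the context. -/

import Mathlib

open Finset

noncomputable section

namespace Jet

/-- Smooth real-valued functions of `(t, x, y) ∈ ℝ × ℝⁿ × ℝⁿ`, the local coordinates
of the 1-jet space `J¹(ℝ, M)`. -/
abbrev Fn (n : ℕ) : Type := ℝ → (Fin n → ℝ) → (Fin n → ℝ) → ℝ

def Smooth {n : ℕ} (F : Fn n) : Prop :=
  ContDiff ℝ (⊤ : ℕ∞) (fun p : ℝ × (Fin n → ℝ) × (Fin n → ℝ) => F p.1 p.2.1 p.2.2)

/-- Partial derivative in the time variable `t`. -/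
def pt {n : ℕ} (F : Fn n) : Fn n := fun t x y => deriv (fun s => F s x y) t

/-- Partial derivative in the spatial variable `xⁱ`. -/
def px {n : ℕ} (i : Fin n) (F : Fn n) : Fn n :=
  fun t x y => deriv (fun s => F t (Function.update x i s) y) (x i)

/-- Partial derivative in the fibre variable `yⁱ`. -/
def py {n : ℕ} (i : Fin n) (F : Fn n) : Fn n :=
  fun t x y => deriv (fun s => F t x (Function.update y i s)) (y i)

/-- Kronecker delta, as a constant function on the jet space. -/
def kron {n : ℕ} (i j : Fin n) : Fn n := if i = j then 1 else 0

/-- The coordinate function `yⁱ`. -/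
def yc {n : ℕ} (i : Fin n) : Fn n := fun _ _ y => y i

/-- The Christoffel symbol `κ(t) = (1/(2h)) dh/dt` of a Riemannian metric `h` on `ℝ`,
as a function on the jet space. -/
def chr {n : ℕ} (h : ℝ → ℝ) : Fn n := fun t _ _ => deriv h t / (2 * h t)

/-- The metric `h(t)` as a function on the jet space. -/
def hfun {n : ℕ} (h : ℝ → ℝ) : Fn n := fun t _ _ => h t

/-- The derivative `dh/dt` as a function on the jet space. -/
def hder {n : ℕ} (h : ℝ → ℝ) : Fn n := fun t _ _ => deriv h t

variable {n : ℕ}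

/-- The adapted temporal derivative `δ/δt = ∂/∂t − Mʳ ∂/∂yʳ` determined by a
nonlinear connection `(M, N)`. -/
def dt (M : Fin n → Fn n) (F : Fn n) : Fn n := pt F - ∑ r, M r * py r F

/-- The adapted spatial derivative `δ/δxᵏ = ∂/∂xᵏ − Nʳₖ ∂/∂yʳ`. -/
def dx (N : Fin n → Fin n → Fn n) (k : Fin n) (F : Fn n) : Fn n :=
  px k F - ∑ r, N r k * py r F

/-- An `h`-normal `Γ`-linear connection `(κ, Gᵏᵢ, Lᵏᵢⱼ, Cᵏᵢⱼ)`. -/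
structure Conn (n : ℕ) where
  κ : Fn n
  G : Fin n → Fin n → Fn n
  L : Fin n → Fin n → Fin n → Fn n
  C : Fin n → Fin n → Fin n → Fn n

/-! ### Torsion d-tensors -/

/-- `Tʳ₁ⱼ = −Gʳⱼ`. -/
def T1 (Γ : Conn n) (r j : Fin n) : Fn n := -Γ.G r j

/-- `Rvʳ₁ⱼ = (δ/δxʲ)Mʳ − (δ/δt)Nʳⱼ`. -/
def Rv1 (M : Fin n → Fn n) (N : Fin n → Fin n → Fn n) (r j : Fin n) : Fn n :=
  dx N j (M r) - dt M (N r j)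

/-- `Tʳᵢⱼ = Lʳᵢⱼ − Lʳⱼᵢ`. -/
def Tsp (Γ : Conn n) (r i j : Fin n) : Fn n := Γ.L r i j - Γ.L r j i

/-- `Rvʳᵢⱼ = (δ/δxʲ)Nʳᵢ − (δ/δxⁱ)Nʳⱼ`. -/
def Rvsp (M : Fin n → Fn n) (N : Fin n → Fin n → Fn n) (r i j : Fin n) : Fn n :=
  dx N j (N r i) - dx N i (N r j)

/-- `Pvʳ₁ⱼ = ∂Mʳ/∂yʲ − Gʳⱼ + δʳⱼ κ`. -/
def Pv1 (M : Fin n → Fn n) (Γ : Conn n) (r j : Fin n) : Fn n :=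
  py j (M r) - Γ.G r j + kron r j * Γ.κ

/-- `Phʳᵢⱼ = Cʳᵢⱼ`. -/
def Phsp (Γ : Conn n) (r i j : Fin n) : Fn n := Γ.C r i j

/-- `Pvʳᵢⱼ = ∂Nʳᵢ/∂yʲ − Lʳⱼᵢ`. -/
def Pvsp (N : Fin n → Fin n → Fn n) (Γ : Conn n) (r i j : Fin n) : Fn n :=
  py j (N r i) - Γ.L r j i

/-- `Sʳᵢⱼ = Cʳᵢⱼ − Cʳⱼᵢ`. -/
def Ssp (Γ : Conn n) (r i j : Fin n) : Fn n := Γ.C r i j - Γ.C r j i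

/-! ### Generic covariant derivatives of d-tensors -/

/-- Index types of the (valued) indices of a d-tensor: upper/lower spatial,
upper/lower vertical.  (Temporal indices carry no value; they are accounted for by the
temporal weight `p` = number of upper temporal indices minus number of lower temporal
indices.) -/
inductive IdxType | uS | lS | uV | lV

/-- A d-tensor component family with `m` valued indices. -/
abbrev Tensor (n m : ℕ) := (Fin m → Fin n) → Fn n

/-- The `ℝ`-horizontal covariant derivative `D_{/1}` of a d-tensor `D` with valued index
signature `σ` and temporal weight `p`. -/
def covT {m : ℕ} (M : Fin n → Fn n) (Γ : Conn n) (p : ℤ) (σ : Fin m → IdxType)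
    (D : Tensor n m) : Tensor n m := fun a =>
  dt M (D a) + p • (Γ.κ * D a)
    + ∑ q : Fin m,
      (match σ q with
      | .uS => ∑ r, D (Function.update a q r) * Γ.G (a q) r
      | .lS => -∑ r, D (Function.update a q r) * Γ.G r (a q)
      | .uV => ∑ r, D (Function.update a q r) * (Γ.G (a q) r - kron (a q) r * Γ.κ)
      | .lV => -∑ r, D (Function.update a q r) * (Γ.G r (a q) - kron r (a q) * Γ.κ) : Fn n)

/-- The `M`-horizontal covariant derivative `D_{|k}`. -/
def covX {m : ℕ} (N : Fin n → Fin n → Fn n) (Γ : Conn n) (σ : Fin m → IdxType)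
    (k : Fin n) (D : Tensor n m) : Tensor n m := fun a =>
  dx N k (D a)
    + ∑ q : Fin m,
      (match σ q with
      | .uS => ∑ r, D (Function.update a q r) * Γ.L (a q) r k
      | .uV => ∑ r, D (Function.update a q r) * Γ.L (a q) r k
      | .lS => -∑ r, D (Function.update a q r) * Γ.L r (a q) k
      | .lV => -∑ r, D (Function.update a q r) * Γ.L r (a q) k : Fn n)

/-- The vertical covariant derivative `D|_{(k)}`. -/
def covY {m : ℕ} (Γ : Conn n) (σ : Fin m → IdxType)
    (k : Fin n) (D : Tensor n m) : Tensor n m := fun a =>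
  py k (D a)
    + ∑ q : Fin m,
      (match σ q with
      | .uS => ∑ r, D (Function.update a q r) * Γ.C (a q) r k
      | .uV => ∑ r, D (Function.update a q r) * Γ.C (a q) r k
      | .lS => -∑ r, D (Function.update a q r) * Γ.C r (a q) k
      | .lV => -∑ r, D (Function.update a q r) * Γ.C r (a q) k : Fn n)

/-- The coefficients `Cᵏᵢⱼ` viewed as a d-tensor with signature
(upper spatial, lower spatial, lower vertical). -/
def CT (Γ : Conn n) : Tensor n 3 := fun a => Γ.C (a 0) (a 1) (a 2)

/-- The signature of `Cᵏᵢⱼ`. -/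
def sigC : Fin 3 → IdxType := ![IdxType.uS, IdxType.lS, IdxType.lV]

/-! ### Curvature d-tensors -/

/-- `Rˡᵢ₁ₖ`. -/
def Rc1 (M : Fin n → Fn n) (N : Fin n → Fin n → Fn n) (Γ : Conn n) (l i k : Fin n) : Fn n :=
  dx N k (Γ.G l i) - dt M (Γ.L l i k) + ∑ r, Γ.G r i * Γ.L l r k
    - ∑ r, Γ.L r i k * Γ.G l r + ∑ r, Γ.C l i r * Rv1 M N r k

/-- `Rˡᵢⱼₖ`. -/
def Rc (M : Fin n → Fn n) (N : Fin n → Fin n → Fn n) (Γ : Conn n) (l i j k : Fin n) : Fn n :=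
  dx N k (Γ.L l i j) - dx N j (Γ.L l i k) + ∑ r, Γ.L r i j * Γ.L l r k
    - ∑ r, Γ.L r i k * Γ.L l r j + ∑ r, Γ.C l i r * Rvsp M N r j k

/-- `Pˡᵢ₁₍ₖ₎`. -/
def Pc1 (M : Fin n → Fn n) (N : Fin n → Fin n → Fn n) (Γ : Conn n) (l i k : Fin n) : Fn n :=
  py k (Γ.G l i) - covT M Γ 0 sigC (CT Γ) ![l, i, k] + ∑ r, Γ.C l i r * Pv1 M Γ r k

/-- `Pˡᵢⱼ₍ₖ₎`. -/
def Pc (M : Fin n → Fn n) (N : Fin n → Fin n → Fn n) (Γ : Conn n) (l i j k : Fin n) : Fn n :=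
  py k (Γ.L l i j) - covX N Γ sigC j (CT Γ) ![l, i, k] + ∑ r, Γ.C l i r * Pvsp N Γ r j k

/-- `Sˡᵢ₍ⱼ₎₍ₖ₎`. -/
def Sc (Γ : Conn n) (l i j k : Fin n) : Fn n :=
  py k (Γ.C l i j) - py j (Γ.C l i k)
    + ∑ r, Γ.C r i j * Γ.C l r k - ∑ r, Γ.C r i k * Γ.C l r j

end Jet

namespace Jet

variable {n : ℕ}

/-- A vector field on the jet space, given by its coordinate components
`V = Vᵗ ∂/∂t + Vˣⁱ ∂/∂xⁱ + Vʸⁱ ∂/∂yⁱ`. -/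
structure VF (n : ℕ) where
  t : Fn n
  x : Fin n → Fn n
  y : Fin n → Fn n

/-- The action `X(f)` of a vector field on a scalar function. -/
def Xact (X : VF n) (f : Fn n) : Fn n :=
  X.t * pt f + ∑ i, X.x i * px i f + ∑ i, X.y i * py i f

/-- The Lie bracket `[X, Y]` of vector fields, in coordinates. -/
def bracket (X Y : VF n) : VF n :=
  ⟨Xact X Y.t - Xact Y X.t, fun i => Xact X (Y.x i) - Xact Y (X.x i),
    fun i => Xact X (Y.y i) - Xact Y (X.y i)⟩

/-- The adapted vertical component of a vector field:
`V = Vᵗ δ/δt + Vˣⁱ δ/δxⁱ + (aV V)ⁱ ∂/∂yⁱ`. -/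
def aV (M : Fin n → Fn n) (N : Fin n → Fin n → Fn n) (V : VF n) (i : Fin n) : Fn n :=
  V.y i + V.t * M i + ∑ j, V.x j * N i j

/-- The vector field `cT δ/δt + Σᵢ cH i · δ/δxⁱ + Σᵢ cV i · ∂/∂yⁱ`, in coordinates. -/
def comb (M : Fin n → Fn n) (N : Fin n → Fin n → Fn n)
    (cT : Fn n) (cH cV : Fin n → Fn n) : VF n :=
  ⟨cT, cH, fun k => cV k - cT * M k - ∑ r, cH r * N k r⟩

/-- The adapted frame field `δ/δt`. -/
def delt (M : Fin n → Fn n) (N : Fin n → Fin n → Fn n) : VF n := comb M N 1 0 0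

/-- The adapted frame field `δ/δxⁱ`. -/
def delx (M : Fin n → Fn n) (N : Fin n → Fin n → Fn n) (i : Fin n) : VF n :=
  comb M N 0 (fun j => kron j i) 0

/-- The adapted frame field `∂/∂yⁱ`. -/
def party (M : Fin n → Fn n) (N : Fin n → Fin n → Fn n) (i : Fin n) : VF n :=
  comb M N 0 0 (fun r => kron r i)

/-- The covariant derivative `∇_X Z` induced by an `h`-normal `Γ`-linear connection:
it is defined on the adapted frame by
`∇_{δ/δt}(δ/δt) = κ δ/δt`, `∇_{δ/δt}(δ/δxⁱ) = Gᵏᵢ δ/δxᵏ`,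
`∇_{δ/δt}(∂/∂yⁱ) = (Gᵏᵢ − δᵏᵢ κ) ∂/∂yᵏ`, `∇_{δ/δxʲ}(δ/δt) = 0`,
`∇_{δ/δxʲ}(δ/δxⁱ) = Lᵏᵢⱼ δ/δxᵏ`, `∇_{δ/δxʲ}(∂/∂yⁱ) = Lᵏᵢⱼ ∂/∂yᵏ`,
`∇_{∂/∂yʲ}(δ/δt) = 0`, `∇_{∂/∂yʲ}(δ/δxⁱ) = Cᵏᵢⱼ δ/δxᵏ`,
`∇_{∂/∂yʲ}(∂/∂yⁱ) = Cᵏᵢⱼ ∂/∂yᵏ`, and extended by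
`∇_{fX+gY} Z = f ∇_X Z + g ∇_Y Z`, `∇_X (fZ) = X(f) Z + f ∇_X Z`. -/
def nabla (M : Fin n → Fn n) (N : Fin n → Fin n → Fn n) (Γ : Conn n)
    (X Z : VF n) : VF n :=
  let Tc : Fn n := Xact X Z.t + Z.t * X.t * Γ.κ
  let Hc : Fin n → Fn n := fun k =>
    Xact X (Z.x k) + ∑ i, Z.x i *
      (X.t * Γ.G k i + ∑ j, X.x j * Γ.L k i j + ∑ j, aV M N X j * Γ.C k i j)
  let Vc : Fin n → Fn n := fun k =>
    Xact X (aV M N Z k) + ∑ i, aV M N Z i *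
      (X.t * (Γ.G k i - kron k i * Γ.κ) + ∑ j, X.x j * Γ.L k i j
        + ∑ j, aV M N X j * Γ.C k i j)
  ⟨Tc, Hc, fun k => Vc k - Tc * M k - ∑ i, Hc i * N k i⟩

/-- The torsion `T(X,Y) = ∇_X Y − ∇_Y X − [X,Y]`. -/
def Tor (M : Fin n → Fn n) (N : Fin n → Fin n → Fn n) (Γ : Conn n) (X Y : VF n) : VF n :=
  let A := nabla M N Γ X Y
  let B := nabla M N Γ Y X
  let Br := bracket X Y
  ⟨A.t - B.t - Br.t, fun i => A.x i - B.x i - Br.x i, fun i => A.y i - B.y i - Br.y i⟩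

/-- The curvature `R(X,Y)Z = ∇_X ∇_Y Z − ∇_Y ∇_X Z − ∇_{[X,Y]} Z`. -/
def Rcurv (M : Fin n → Fn n) (N : Fin n → Fin n → Fn n) (Γ : Conn n) (X Y Z : VF n) : VF n :=
  let A := nabla M N Γ X (nabla M N Γ Y Z)
  let B := nabla M N Γ Y (nabla M N Γ X Z)
  let Cc := nabla M N Γ (bracket X Y) Z
  ⟨A.t - B.t - Cc.t, fun i => A.x i - B.x i - Cc.x i, fun i => A.y i - B.y i - Cc.y i⟩

/-- The zero vector field. -/
def VF.zero : VF n := ⟨0, 0, 0⟩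

/-- `X` is one of the adapted frame fields. -/
def IsAdapted (M : Fin n → Fn n) (N : Fin n → Fin n → Fn n) (X : VF n) : Prop :=
  X = delt M N ∨ (∃ i, X = delx M N i) ∨ (∃ i, X = party M N i)

end Jet

namespace Jet

variable {n : ℕ}

/-- The connection matrix of `∇_X` on the horizontal frame `δ/δxⁱ`. -/
def horMat (M : Fin n → Fn n) (N : Fin n → Fin n → Fn n) (Γ : Conn n) (X : VF n)
    (k i : Fin n) : Fn n :=
  X.t * Γ.G k i + ∑ j, X.x j * Γ.L k i j + ∑ j, aV M N X j * Γ.C k i j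

/-- The connection matrix of `∇_X` on the vertical frame `∂/∂yⁱ`. -/
def verMat (M : Fin n → Fn n) (N : Fin n → Fin n → Fn n) (Γ : Conn n) (X : VF n)
    (k i : Fin n) : Fn n :=
  X.t * (Γ.G k i - kron k i * Γ.κ) + ∑ j, X.x j * Γ.L k i j + ∑ j, aV M N X j * Γ.C k i j

section PartialDerivatives

lemma pt_zero : pt (0 : Fn n) = 0 := by
  funext t x y; simp [pt]

lemma px_zero (k : Fin n) : px k (0 : Fn n) = 0 := by
  funext t x y; simp [px]

lemma py_zero (k : Fin n) : py k (0 : Fn n) = 0 := by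
  funext t x y; simp [py]

lemma pt_one : pt (1 : Fn n) = 0 := by
  funext t x y; simp [pt]

lemma px_one (k : Fin n) : px k (1 : Fn n) = 0 := by
  funext t x y; simp [px]

lemma py_one (k : Fin n) : py k (1 : Fn n) = 0 := by
  funext t x y; simp [py]

lemma pt_neg (F : Fn n) : pt (-F) = -pt F := by
  funext t x y; simp [pt]

lemma px_neg (k : Fin n) (F : Fn n) : px k (-F) = -px k F := by
  funext t x y; simp [px]

lemma py_neg (k : Fin n) (F : Fn n) : py k (-F) = -py k F := by
  funext t x y; simp [py]

lemma kron_apply (i j : Fin n) (t : ℝ) (x y : Fin n → ℝ) :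
    (kron i j : Fn n) t x y = if i = j then 1 else 0 := by
  unfold kron; split_ifs <;> rfl

lemma px_chr (k : Fin n) (h : ℝ → ℝ) : px k (chr h : Fn n) = 0 := by
  funext t x y; simp [px, chr]

lemma py_chr (k : Fin n) (h : ℝ → ℝ) : py k (chr h : Fn n) = 0 := by
  funext t x y; simp [py, chr]

lemma px_sub_kron_mul_chr (k i j : Fin n) (F : Fn n) (h : ℝ → ℝ) :
    px k (F - kron i j * chr h) = px k F := by
  funext t x y; simp [px, chr, kron_apply, deriv_sub_const]

lemma py_sub_kron_mul_chr (k i j : Fin n) (F : Fn n) (h : ℝ → ℝ) :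
    py k (F - kron i j * chr h) = py k F := by
  funext t x y; simp [py, chr, kron_apply, deriv_sub_const]

end PartialDerivatives

section VectorFields

lemma Xact_zero (X : VF n) : Xact X 0 = 0 := by
  simp [Xact, pt_zero, px_zero, py_zero]

lemma Xact_one (X : VF n) : Xact X 1 = 0 := by
  simp [Xact, pt_one, px_one, py_one]

lemma Xact_kron (X : VF n) (i j : Fin n) : Xact X (kron i j) = 0 := by
  unfold kron; split_ifs
  · exact Xact_one X
  · exact Xact_zero X

lemma Xact_neg (X : VF n) (F : Fn n) : Xact X (-F) = -Xact X F := by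
  simp only [Xact, pt_neg, px_neg, py_neg, mul_neg, sum_neg_distrib]
  ring

variable (M : Fin n → Fn n) (N : Fin n → Fin n → Fn n) (Γ : Conn n)

lemma sum_kron_mul (i : Fin n) (F : Fin n → Fn n) : ∑ r, kron r i * F r = F i := by
  simp [kron]

lemma aV_comb (a : Fn n) (b c : Fin n → Fn n) : aV M N (comb M N a b c) = c := by
  refine funext fun k => ?_
  simp only [aV, comb]
  ring

lemma delt_y (k : Fin n) : (delt M N).y k = -M k := by
  simp [delt, comb]

lemma delx_y (i k : Fin n) : (delx M N i).y k = -N k i := by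
  simp [delx, comb, sum_kron_mul]

lemma party_y (i k : Fin n) : (party M N i).y k = kron k i := by
  simp [party, comb]

lemma Xact_delt (F : Fn n) : Xact (delt M N) F = dt M F := by
  simp only [Xact, delt_y, dt]
  simp [delt, comb, sub_eq_add_neg]

lemma Xact_delx (i : Fin n) (F : Fn n) : Xact (delx M N i) F = dx N i F := by
  simp only [Xact, delx_y, dx]
  simp [delx, comb, sub_eq_add_neg, sum_kron_mul]

lemma Xact_party (i : Fin n) (F : Fn n) : Xact (party M N i) F = py i F := by
  simp only [Xact, party_y, sum_kron_mul]
  simp [party, comb]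

lemma nabla_eq_comb (X Z : VF n) : nabla M N Γ X Z =
    comb M N (Xact X Z.t + Z.t * X.t * Γ.κ)
      (fun k => Xact X (Z.x k) + ∑ i, Z.x i * horMat M N Γ X k i)
      (fun k => Xact X (aV M N Z k) + ∑ i, aV M N Z i * verMat M N Γ X k i) := rfl

lemma nabla_comb (X : VF n) (a : Fn n) (b c : Fin n → Fn n) :
    nabla M N Γ X (comb M N a b c) =
      comb M N (Xact X a + a * X.t * Γ.κ)
        (fun k => Xact X (b k) + ∑ i, b i * horMat M N Γ X k i)
        (fun k => Xact X (c k) + ∑ i, c i * verMat M N Γ X k i) := by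
  rw [nabla_eq_comb, aV_comb]
  rfl

lemma comb_sub_sub (a a' a'' : Fn n) (b b' b'' c c' c'' : Fin n → Fn n) :
    (⟨(comb M N a b c).t - (comb M N a' b' c').t - (comb M N a'' b'' c'').t,
      fun i => (comb M N a b c).x i - (comb M N a' b' c').x i - (comb M N a'' b'' c'').x i,
      fun i => (comb M N a b c).y i - (comb M N a' b' c').y i - (comb M N a'' b'' c'').y i⟩
        : VF n) =
      comb M N (a - a' - a'') (fun i => b i - b' i - b'' i) (fun i => c i - c' i - c'' i) := by
  simp only [comb, VF.mk.injEq, true_and]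
  refine funext fun k => ?_
  simp only [sub_mul, sum_sub_distrib]
  ring

lemma Rcurv_delt (X Y : VF n) : Rcurv M N Γ X Y (delt M N) =
    comb M N (Xact X (Y.t * Γ.κ) - Xact Y (X.t * Γ.κ) - (bracket X Y).t * Γ.κ) 0 0 := by
  have hT : ∀ W, nabla M N Γ W (delt M N) = comb M N (W.t * Γ.κ) 0 0 := fun W => by
    simp only [delt, nabla_comb, Xact_one, Pi.zero_apply, Xact_zero, zero_mul, sum_const_zero,
      add_zero, zero_add, one_mul]
    rfl
  simp only [Rcurv, hT, nabla_comb, comb_sub_sub, Pi.zero_apply, Xact_zero, zero_mul,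
    sum_const_zero, add_zero, sub_zero]
  congr 1
  ring

lemma Rcurv_delx (X Y : VF n) (i : Fin n) : Rcurv M N Γ X Y (delx M N i) =
    comb M N 0 (fun l =>
      Xact X (horMat M N Γ Y l i) + ∑ r, horMat M N Γ Y r i * horMat M N Γ X l r
        - (Xact Y (horMat M N Γ X l i) + ∑ r, horMat M N Γ X r i * horMat M N Γ Y l r)
        - horMat M N Γ (bracket X Y) l i) 0 := by
  have hT : ∀ W, nabla M N Γ W (delx M N i) = comb M N 0 (fun k => horMat M N Γ W k i) 0 :=
    fun W => by
      simp only [delx, nabla_comb, Xact_kron, Pi.zero_apply, Xact_zero, zero_mul, sum_const_zero,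
        add_zero, zero_add, sum_kron_mul]
      rfl
  simp only [Rcurv, hT, nabla_comb, comb_sub_sub, Pi.zero_apply, Xact_zero, zero_mul,
    sum_const_zero, add_zero, sub_zero]
  rfl

lemma Rcurv_party (X Y : VF n) (i : Fin n) : Rcurv M N Γ X Y (party M N i) =
    comb M N 0 0 (fun l =>
      Xact X (verMat M N Γ Y l i) + ∑ r, verMat M N Γ Y r i * verMat M N Γ X l r
        - (Xact Y (verMat M N Γ X l i) + ∑ r, verMat M N Γ X r i * verMat M N Γ Y l r)
        - verMat M N Γ (bracket X Y) l i) := by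
  have hT : ∀ W, nabla M N Γ W (party M N i) = comb M N 0 0 (fun k => verMat M N Γ W k i) :=
    fun W => by
      simp only [party, nabla_comb, Xact_kron, Pi.zero_apply, Xact_zero, zero_mul, sum_const_zero,
        add_zero, zero_add, sum_kron_mul]
      rfl
  simp only [Rcurv, hT, nabla_comb, comb_sub_sub, Pi.zero_apply, Xact_zero, zero_mul,
    sum_const_zero, add_zero, sub_zero]
  rfl

end VectorFields

section AdaptedFrame

variable (M : Fin n → Fn n) (N : Fin n → Fin n → Fn n) (Γ : Conn n)

lemma horMat_delt (k i : Fin n) : horMat M N Γ (delt M N) k i = Γ.G k i := by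
  simp only [horMat, delt, aV_comb]
  simp [comb]

lemma horMat_delx (j k i : Fin n) : horMat M N Γ (delx M N j) k i = Γ.L k i j := by
  simp only [horMat, delx, aV_comb]
  simp [comb, sum_kron_mul]

lemma horMat_party (j k i : Fin n) : horMat M N Γ (party M N j) k i = Γ.C k i j := by
  simp only [horMat, party, aV_comb]
  simp [comb, sum_kron_mul]

lemma verMat_delt (k i : Fin n) :
    verMat M N Γ (delt M N) k i = Γ.G k i - kron k i * Γ.κ := by
  simp only [verMat, delt, aV_comb]
  simp [comb]

lemma verMat_delx (j k i : Fin n) : verMat M N Γ (delx M N j) k i = Γ.L k i j := by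
  simp only [verMat, delx, aV_comb]
  simp [comb, sum_kron_mul]

lemma verMat_party (j k i : Fin n) : verMat M N Γ (party M N j) k i = Γ.C k i j := by
  simp only [verMat, party, aV_comb]
  simp [comb, sum_kron_mul]

lemma IsAdapted.Xact_t {X Y : VF n} (hY : IsAdapted M N Y) : Xact X Y.t = 0 := by
  rcases hY with rfl | ⟨i, rfl⟩ | ⟨i, rfl⟩
  · exact Xact_one X
  · exact Xact_zero X
  · exact Xact_zero X

lemma IsAdapted.Xact_x {X Y : VF n} (hY : IsAdapted M N Y) (k : Fin n) :
    Xact X (Y.x k) = 0 := by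
  rcases hY with rfl | ⟨i, rfl⟩ | ⟨i, rfl⟩
  · exact Xact_zero X
  · exact Xact_kron X k i
  · exact Xact_zero X

lemma isAdapted_delt : IsAdapted M N (delt M N) := Or.inl rfl

lemma isAdapted_delx (i : Fin n) : IsAdapted M N (delx M N i) := Or.inr (Or.inl ⟨i, rfl⟩)

lemma isAdapted_party (i : Fin n) : IsAdapted M N (party M N i) := Or.inr (Or.inr ⟨i, rfl⟩)

/-- Brackets of adapted frame fields are vertical. -/
lemma bracket_of_isAdapted {X Y : VF n} (hX : IsAdapted M N X) (hY : IsAdapted M N Y) :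
    bracket X Y = ⟨0, 0, fun i => Xact X (Y.y i) - Xact Y (X.y i)⟩ := by
  simp only [bracket, hX.Xact_t, hY.Xact_t, hX.Xact_x, hY.Xact_x, sub_zero]
  rfl

lemma horMat_bracket {X Y : VF n} (hX : IsAdapted M N X) (hY : IsAdapted M N Y)
    (k i : Fin n) : horMat M N Γ (bracket X Y) k i =
      ∑ r, Γ.C k i r * (Xact X (Y.y r) - Xact Y (X.y r)) := by
  simp [bracket_of_isAdapted M N hX hY, horMat, aV, mul_comm]

lemma verMat_bracket {X Y : VF n} (hX : IsAdapted M N X) (hY : IsAdapted M N Y)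
    (k i : Fin n) : verMat M N Γ (bracket X Y) k i =
      ∑ r, Γ.C k i r * (Xact X (Y.y r) - Xact Y (X.y r)) := by
  simp [bracket_of_isAdapted M N hX hY, verMat, aV, mul_comm]

lemma dx_sub_kron_mul_chr (k i j : Fin n) (F : Fn n) (h : ℝ → ℝ) :
    dx N k (F - kron i j * chr h) = dx N k F := by
  simp only [dx, px_sub_kron_mul_chr, py_sub_kron_mul_chr]

lemma dx_chr (k : Fin n) (h : ℝ → ℝ) : dx N k (chr h : Fn n) = 0 := by
  simp [dx, px_chr, py_chr]

/-- The connection matrices on the horizontal and the vertical frame differ by a scalar matrix,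
so they have the same commutators. -/
lemma sum_sub_kron_mul_comm (A B : Fin n → Fin n → Fn n) (f : Fn n) (l i : Fin n) :
    ∑ r, (A r i - kron r i * f) * B l r - ∑ r, B r i * (A l r - kron l r * f) =
      ∑ r, A r i * B l r - ∑ r, B r i * A l r := by
  simp only [sub_mul, mul_sub, sum_sub_distrib]
  have h₁ : ∑ r, kron r i * f * B l r = f * B l i := by
    simp only [mul_assoc, sum_kron_mul]
  have h₂ : ∑ r, B r i * (kron l r * f) = f * B l i := by
    simp [kron, mul_comm]
  rw [h₁, h₂]
  ring

lemma covT_CT (l i k : Fin n) : covT M Γ 0 sigC (CT Γ) ![l, i, k] =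
    dt M (Γ.C l i k) + ∑ r, Γ.C r i k * Γ.G l r - ∑ r, Γ.C l r k * Γ.G r i
      - ∑ r, Γ.C l i r * (Γ.G r k - kron r k * Γ.κ) := by
  simp [covT, sigC, CT, Fin.sum_univ_three, Function.update]
  ring

lemma covX_CT (l i j k : Fin n) : covX N Γ sigC j (CT Γ) ![l, i, k] =
    dx N j (Γ.C l i k) + ∑ r, Γ.C r i k * Γ.L l r j - ∑ r, Γ.C l r k * Γ.L r i j
      - ∑ r, Γ.C l i r * Γ.L r k j := by
  simp [covX, sigC, CT, Fin.sum_univ_three, Function.update]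
  ring

lemma Pc1_eq (l i k : Fin n) : Pc1 M N Γ l i k =
    py k (Γ.G l i) - dt M (Γ.C l i k) + ∑ r, Γ.G r i * Γ.C l r k - ∑ r, Γ.C r i k * Γ.G l r
      + ∑ r, Γ.C l i r * py k (M r) := by
  simp only [Pc1, covT_CT, Pv1, mul_sub, mul_add, sum_sub_distrib, sum_add_distrib,
    mul_comm (Γ.G _ i)]
  ring

lemma Pc_eq (l i j k : Fin n) : Pc M N Γ l i j k =
    py k (Γ.L l i j) - dx N j (Γ.C l i k) + ∑ r, Γ.L r i j * Γ.C l r k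
      - ∑ r, Γ.C r i k * Γ.L l r j + ∑ r, Γ.C l i r * py k (N r j) := by
  simp only [Pc, covX_CT, Pvsp, mul_sub, sum_sub_distrib, mul_comm (Γ.L _ i j)]
  ring

end AdaptedFrame

end Jet

namespace Jet

/-- the curvature of the covariant derivative induced by an `h`-normal
Γ-linear connection, on the adapted frame. -/
theorem curvature_of_h_normal_connection
    (n : ℕ) (hn : 1 ≤ n)
    (h : ℝ → ℝ) (hh : ContDiff ℝ (⊤ : ℕ∞) h) (hhpos : ∀ t, 0 < h t)
    (M : Fin n → Fn n) (N : Fin n → Fin n → Fn n) (Γ : Conn n)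
    (hκ : Γ.κ = chr h)
    (hMs : ∀ i, Smooth (M i)) (hNs : ∀ i j, Smooth (N i j))
    (hGs : ∀ k i, Smooth (Γ.G k i)) (hLs : ∀ k i j, Smooth (Γ.L k i j))
    (hCs : ∀ k i j, Smooth (Γ.C k i j)) :
    (∀ X Y, IsAdapted M N X → IsAdapted M N Y → Rcurv M N Γ X Y (delt M N) = VF.zero)
      ∧ (∀ i k, Rcurv M N Γ (delx M N k) (delt M N) (delx M N i)
          = comb M N 0 (fun l => Rc1 M N Γ l i k) 0)
      ∧ (∀ i k, Rcurv M N Γ (delx M N k) (delt M N) (party M N i)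
          = comb M N 0 0 (fun l => Rc1 M N Γ l i k))
      ∧ (∀ i j k, Rcurv M N Γ (delx M N k) (delx M N j) (delx M N i)
          = comb M N 0 (fun l => Rc M N Γ l i j k) 0)
      ∧ (∀ i j k, Rcurv M N Γ (delx M N k) (delx M N j) (party M N i)
          = comb M N 0 0 (fun l => Rc M N Γ l i j k))
      ∧ (∀ i k, Rcurv M N Γ (party M N k) (delt M N) (delx M N i)
          = comb M N 0 (fun l => Pc1 M N Γ l i k) 0)
      ∧ (∀ i k, Rcurv M N Γ (party M N k) (delt M N) (party M N i)
          = comb M N 0 0 (fun l => Pc1 M N Γ l i k))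
      ∧ (∀ i j k, Rcurv M N Γ (party M N k) (delx M N j) (delx M N i)
          = comb M N 0 (fun l => Pc M N Γ l i j k) 0)
      ∧ (∀ i j k, Rcurv M N Γ (party M N k) (delx M N j) (party M N i)
          = comb M N 0 0 (fun l => Pc M N Γ l i j k))
      ∧ (∀ i j k, Rcurv M N Γ (party M N k) (party M N j) (delx M N i)
          = comb M N 0 (fun l => Sc Γ l i j k) 0)
      ∧ (∀ i j k, Rcurv M N Γ (party M N k) (party M N j) (party M N i)
          = comb M N 0 0 (fun l => Sc Γ l i j k)) := by
  refine ⟨fun X Y hX hY => ?_, fun i k => ?_, fun i k => ?_, fun i j k => ?_, fun i j k => ?_,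
    fun i k => ?_, fun i k => ?_, fun i j k => ?_, fun i j k => ?_, fun i j k => ?_,
    fun i j k => ?_⟩
  · have hκ_act : ∀ U V : VF n, IsAdapted M N U → IsAdapted M N V →
        Xact U (V.t * Γ.κ) - Xact V (U.t * Γ.κ) = 0 := by
      have ht : (delt M N).t = 1 := rfl
      have hx : ∀ i, (delx M N i).t = 0 := fun _ => rfl
      have hy : ∀ i, (party M N i).t = 0 := fun _ => rfl
      rintro U V (rfl | ⟨i, rfl⟩ | ⟨i, rfl⟩) (rfl | ⟨j, rfl⟩ | ⟨j, rfl⟩) <;>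
        simp [ht, hx, hy, Xact_zero, Xact_delx, Xact_party, hκ, dx_chr, py_chr]
    rw [Rcurv_delt, hκ_act X Y hX hY, bracket_of_isAdapted M N hX hY]
    simp only [comb, VF.zero, VF.mk.injEq]
    refine ⟨by simp, trivial, funext fun k => by simp⟩
  · rw [Rcurv_delx]
    congr 1
    refine funext fun l => ?_
    rw [horMat_bracket M N Γ (isAdapted_delx M N k) (isAdapted_delt M N)]
    simp only [horMat_delt, horMat_delx, delt_y, delx_y, Xact_neg, Xact_delt, Xact_delx, Rc1, Rv1]
    simp only [mul_sub, mul_neg, sum_sub_distrib, sum_neg_distrib]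
    ring
  · rw [Rcurv_party]
    congr 1
    refine funext fun l => ?_
    rw [verMat_bracket M N Γ (isAdapted_delx M N k) (isAdapted_delt M N)]
    simp only [verMat_delt, verMat_delx, delt_y, delx_y, Xact_neg, Xact_delt, Xact_delx, Rc1, Rv1]
    have hcomm := sum_sub_kron_mul_comm Γ.G (fun l r => Γ.L l r k) Γ.κ l i
    rw [hκ] at hcomm ⊢
    rw [dx_sub_kron_mul_chr]
    simp only [mul_sub, mul_neg, sum_sub_distrib, sum_neg_distrib] at hcomm ⊢
    linear_combination hcomm
  · rw [Rcurv_delx]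
    congr 1
    refine funext fun l => ?_
    rw [horMat_bracket M N Γ (isAdapted_delx M N k) (isAdapted_delx M N j)]
    simp only [horMat_delx, delx_y, Xact_neg, Xact_delx, Rc, Rvsp]
    simp only [mul_sub, mul_neg, sum_sub_distrib, sum_neg_distrib]
    ring
  · rw [Rcurv_party]
    congr 1
    refine funext fun l => ?_
    rw [verMat_bracket M N Γ (isAdapted_delx M N k) (isAdapted_delx M N j)]
    simp only [verMat_delx, delx_y, Xact_neg, Xact_delx, Rc, Rvsp]
    simp only [mul_sub, mul_neg, sum_sub_distrib, sum_neg_distrib]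
    ring
  · rw [Rcurv_delx]
    congr 1
    refine funext fun l => ?_
    rw [horMat_bracket M N Γ (isAdapted_party M N k) (isAdapted_delt M N)]
    simp only [horMat_delt, horMat_party, delt_y, party_y, Xact_neg, Xact_kron, Xact_delt,
      Xact_party, Pc1_eq]
    simp only [mul_sub, mul_neg, mul_zero, sum_sub_distrib, sum_neg_distrib, sum_const_zero]
    ring
  · rw [Rcurv_party]
    congr 1
    refine funext fun l => ?_
    rw [verMat_bracket M N Γ (isAdapted_party M N k) (isAdapted_delt M N)]
    simp only [verMat_delt, verMat_party, delt_y, party_y, Xact_neg, Xact_kron, Xact_delt,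
      Xact_party, Pc1_eq]
    have hcomm := sum_sub_kron_mul_comm Γ.G (fun l r => Γ.C l r k) Γ.κ l i
    rw [hκ] at hcomm ⊢
    rw [py_sub_kron_mul_chr]
    simp only [mul_sub, mul_neg, mul_zero, sum_sub_distrib, sum_neg_distrib,
      sum_const_zero] at hcomm ⊢
    linear_combination hcomm
  · rw [Rcurv_delx]
    congr 1
    refine funext fun l => ?_
    rw [horMat_bracket M N Γ (isAdapted_party M N k) (isAdapted_delx M N j)]
    simp only [horMat_delx, horMat_party, delx_y, party_y, Xact_neg, Xact_kron, Xact_delx,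
      Xact_party, Pc_eq]
    simp only [mul_sub, mul_neg, mul_zero, sum_sub_distrib, sum_neg_distrib, sum_const_zero]
    ring
  · rw [Rcurv_party]
    congr 1
    refine funext fun l => ?_
    rw [verMat_bracket M N Γ (isAdapted_party M N k) (isAdapted_delx M N j)]
    simp only [verMat_delx, verMat_party, delx_y, party_y, Xact_neg, Xact_kron, Xact_delx,
      Xact_party, Pc_eq]
    simp only [mul_sub, mul_neg, mul_zero, sum_sub_distrib, sum_neg_distrib, sum_const_zero]
    ring
  · rw [Rcurv_delx]
    congr 1
    refine funext fun l => ?_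
    rw [horMat_bracket M N Γ (isAdapted_party M N k) (isAdapted_party M N j)]
    simp only [horMat_party, party_y, Xact_kron, Xact_party, Sc]
    simp only [mul_sub, mul_zero, sum_sub_distrib, sum_const_zero]
    ring
  · rw [Rcurv_party]
    congr 1
    refine funext fun l => ?_
    rw [verMat_bracket M N Γ (isAdapted_party M N k) (isAdapted_party M N j)]
    simp only [verMat_party, party_y, Xact_kron, Xact_party, Sc]
    simp only [mul_sub, mul_zero, sum_sub_distrib, sum_const_zero]
    ring

end Jet
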